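/- Fix positive integers n, s, b with 1 ≤ s ≤ n−1. There exists an s-overlap cycle on the set of all juggling sequences of period n using at most b balls if and only if n − s > gcd(n,s). -/

import Mathlib

/-- `L` is an `s`-overlap cycle on the set `C` of strings of length `n`:
a cyclic ordering (a list, read cyclically) in which every element of `C`
appears exactly once and the length-`s` suffix of each string equals the
length-`s` prefix of the (cyclically) next string. -/
def IsOvCycle (n s : ℕ) {α : Type*} (C : Set (List α)) (L : List (List α)) : Prop :=
  L.Nodup ∧ (∀ x, x ∈ L ↔ x ∈ C) ∧
    ∀ i : Fin L.length,
      (L.get i).drop (n - s) =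
        (L.get ⟨((i : ℕ) + 1) % L.length, Nat.mod_lt _ i.pos⟩).take s

/-- A list `T` of nonnegative integers is a juggling sequence of period `n` when it
has length `n` and the map `i ↦ (i + t_i) mod n` is a bijection of `{0,…,n-1}`. -/
def IsJugglingList (n : ℕ) (T : List ℕ) : Prop :=
  T.length = n ∧
    Function.Bijective (fun i : Fin n =>
      (⟨((i : ℕ) + T.getD (i : ℕ) 0) % n, Nat.mod_lt _ i.pos⟩ : Fin n))

/-! ### Merging the cycles of a permutation -/

section CycleMerging

variable {α β : Type*}

lemma mem_of_sameCycle_of_mapsTo [Finite α] {σ : Equiv.Perm α} {S : Set α}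
    (hS : ∀ z ∈ S, σ z ∈ S) {x y : α} (hxy : σ.SameCycle x y) (hx : x ∈ S) : y ∈ S := by
  obtain ⟨i, -, rfl⟩ := hxy.exists_pow_eq'
  induction i with
  | zero => simpa using hx
  | succ k ih =>
    rw [pow_succ', Equiv.Perm.mul_apply]
    exact hS _ (ih ⟨k, by simp⟩)

/-- Composing with a transposition of two points in different cycles merges these cycles. -/
lemma sameCycle_mul_swap [Finite α] [DecidableEq α] {σ : Equiv.Perm α} {x y : α}
    (hxy : ¬ σ.SameCycle x y) :
    (σ * Equiv.swap x y).SameCycle x y ∧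
      ∀ z, σ.SameCycle x z → (σ * Equiv.swap x y).SameCycle x z := by
  set τ := σ * Equiv.swap x y with hτ
  have hτx : τ x = σ y := by simp [hτ]
  have hτy : τ y = σ x := by simp [hτ]
  have hτz : ∀ z, z ≠ x → z ≠ y → τ z = σ z := fun z h1 h2 => by
    simp [hτ, Equiv.swap_apply_of_ne_of_ne h1 h2]
  have hmem : τ.SameCycle x y := by
    by_contra hy
    have key : y ∈ {z | σ.SameCycle y z ∧ τ.SameCycle x z} := by
      refine mem_of_sameCycle_of_mapsTo (σ := σ) (x := σ y) ?_ ?_ ?_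
      · rintro z ⟨h1, h2⟩
        have hzx : z ≠ x := fun h => hxy (h ▸ h1.symm)
        have hzy : z ≠ y := fun h => hy (h ▸ h2)
        refine ⟨Equiv.Perm.sameCycle_apply_right.2 h1, ?_⟩
        rw [← hτz z hzx hzy]
        exact Equiv.Perm.sameCycle_apply_right.2 h2
      · exact Equiv.Perm.sameCycle_apply_left.2 (Equiv.Perm.SameCycle.refl _ _)
      · refine ⟨Equiv.Perm.sameCycle_apply_right.2 (Equiv.Perm.SameCycle.refl _ _), ?_⟩
        rw [← hτx]
        exact Equiv.Perm.sameCycle_apply_right.2 (Equiv.Perm.SameCycle.refl _ _)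
    exact hy key.2
  refine ⟨hmem, fun z hz => ?_⟩
  refine mem_of_sameCycle_of_mapsTo (S := {z | τ.SameCycle x z}) ?_ hz
    (Equiv.Perm.SameCycle.refl _ _)
  intro w hw
  change τ.SameCycle x (σ w)
  by_cases h1 : w = x
  · rw [h1, ← hτy]
    exact Equiv.Perm.sameCycle_apply_right.2 hmem
  by_cases h2 : w = y
  · rw [h2, ← hτx]
    exact Equiv.Perm.sameCycle_apply_right.2 (Equiv.Perm.SameCycle.refl _ _)
  rw [← hτz w h1 h2]
  exact Equiv.Perm.sameCycle_apply_right.2 hw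

/-- Elements `x` are viewed as the edges `pre x ⟶ suf x` of a digraph that is balanced
(witnessed by `ρ`) and connected; the conclusion is that the digraph has an Eulerian circuit,
expressed as a transitive permutation. -/
lemma exists_perm_sameCycle_of_connected [Finite α] (pre suf : α → β) (ρ : Equiv.Perm α)
    (hρ : ∀ x, pre (ρ x) = suf x) (x₀ : α)
    (hconn : ∀ O : Set α, O.Nonempty → (∀ x, x ∈ O ↔ ρ x ∈ O) →
      (∀ x y, suf x = suf y → x ∈ O → y ∈ O) → O = Set.univ) :
    ∃ σ : Equiv.Perm α, (∀ x, pre (σ x) = suf x) ∧ ∀ x, σ.SameCycle x₀ x := by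
  classical
  obtain ⟨σ, hσ, hmax⟩ := Set.exists_max_image {σ : Equiv.Perm α | ∀ x, pre (σ x) = suf x}
    (fun σ => {y | σ.SameCycle x₀ y}.ncard) (Set.toFinite _) ⟨ρ, hρ⟩
  have hσ' : ∀ x, pre (σ x) = suf x := hσ
  have hclosed : ∀ x y, suf x = suf y → σ.SameCycle x₀ x → σ.SameCycle x₀ y := by
    intro x y hs hx
    by_contra hy
    have hxy : ¬ σ.SameCycle x y := fun h => hy (hx.trans h)
    obtain ⟨h1, h2⟩ := sameCycle_mul_swap hxy
    have hτ : σ * Equiv.swap x y ∈ {σ : Equiv.Perm α | ∀ x, pre (σ x) = suf x} := by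
      intro z
      rw [Equiv.Perm.mul_apply, hσ']
      rcases eq_or_ne z x with rfl | hzx
      · simp [hs]
      rcases eq_or_ne z y with rfl | hzy
      · simp [hs]
      rw [Equiv.swap_apply_of_ne_of_ne hzx hzy]
    have hx₀ := (h2 x₀ hx.symm).symm
    refine absurd (hmax _ hτ) (not_le.2 (Set.ncard_lt_ncard ?_))
    refine ⟨fun z hz => hx₀.trans (h2 z (hx.symm.trans hz)), fun h => hy (h (hx₀.trans h1))⟩
  refine ⟨σ, hσ', fun z => ?_⟩
  have huniv : {y | σ.SameCycle x₀ y} = Set.univ := by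
    refine hconn _ ⟨x₀, Equiv.Perm.SameCycle.refl _ _⟩ (fun x => ?_) hclosed
    have hsuf : suf (σ⁻¹ (ρ x)) = suf x := by
      rw [← hσ', ← hρ]
      simp
    change σ.SameCycle x₀ x ↔ σ.SameCycle x₀ (ρ x)
    have hinv : σ.SameCycle x₀ (ρ x) ↔ σ.SameCycle x₀ (σ⁻¹ (ρ x)) := by
      rw [← Equiv.Perm.sameCycle_apply_right (y := σ⁻¹ (ρ x))]
      simp
    rw [hinv]
    exact ⟨hclosed _ _ hsuf.symm, hclosed _ _ hsuf⟩
  exact huniv.ge (Set.mem_univ z)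

/-- A transitive permutation lists all elements cyclically. -/
lemma exists_list_of_sameCycle [Finite α] (σ : Equiv.Perm α) (x₀ : α)
    (h : ∀ x, σ.SameCycle x₀ x) :
    ∃ L : List α, L.Nodup ∧ (∀ x, x ∈ L) ∧ ∀ i : Fin L.length,
      L.get ⟨((i : ℕ) + 1) % L.length, Nat.mod_lt _ i.pos⟩ = σ (L.get i) := by
  set m := Function.minimalPeriod σ x₀ with hm
  have hpos : 0 < m :=
    Function.minimalPeriod_pos_of_mem_periodicPts
      (σ.injective.mem_periodicPts x₀)
  refine ⟨(List.range m).map fun i => σ^[i] x₀, ?_, fun x => ?_, fun i => ?_⟩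
  · refine List.Nodup.map_on (fun a ha b hb hab => ?_) List.nodup_range
    exact Function.iterate_injOn_Iio_minimalPeriod (by simpa using ha) (by simpa using hb) hab
  · obtain ⟨i, -, rfl⟩ := (h x).exists_pow_eq'
    refine List.mem_map.2 ⟨i % m, List.mem_range.2 (Nat.mod_lt _ hpos), ?_⟩
    rw [Function.iterate_mod_minimalPeriod_eq, Equiv.Perm.iterate_eq_pow]
  · simp only [List.get_eq_getElem, List.getElem_map, List.getElem_range, List.length_map,
      List.length_range]
    rw [Function.iterate_mod_minimalPeriod_eq, Function.iterate_succ_apply']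

end CycleMerging

/-! ### Juggling sequences as functions on `ZMod n` -/

/-- `t` is a juggling sequence, indexed by residues. -/
def IsJugglingFun {n : ℕ} (t : ZMod n → ℕ) : Prop :=
  Function.Bijective fun i : ZMod n => i + (t i : ZMod n)

namespace IsJugglingFun

variable {n : ℕ}

lemma rotate {t : ZMod n → ℕ} (ht : IsJugglingFun t) (r : ZMod n) :
    IsJugglingFun fun i => t (i - r) := by
  have h : (fun i : ZMod n => i + (t (i - r) : ZMod n)) =
      Equiv.addRight r ∘ (fun i : ZMod n => i + (t i : ZMod n)) ∘ Equiv.subRight r := by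
    funext i
    simp only [Function.comp_apply, Equiv.coe_addRight, Equiv.subRight_apply]
    ring
  unfold IsJugglingFun
  rw [h]
  exact (Equiv.bijective _).comp (ht.comp (Equiv.bijective _))

lemma dvd_sum [NeZero n] {t : ZMod n → ℕ} (ht : IsJugglingFun t) : n ∣ ∑ i, t i := by
  have h := Function.Bijective.sum_comp ht (fun i : ZMod n => i)
  rw [Finset.sum_add_distrib] at h
  rw [← ZMod.natCast_eq_zero_iff]
  push_cast
  simpa using h

/-- A descent drops by at least two, so exchanging the landing sites of the two throws flattens
the sequence. -/
lemma exists_flatter [NeZero n] {t : ZMod n → ℕ} (hn : 1 < n) (ht : IsJugglingFun t) {i : ZMod n}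
    (hi : t (i + 1) < t i) :
    ∃ t' : ZMod n → ℕ, IsJugglingFun t' ∧ ∑ j, t' j = ∑ j, t j ∧
      ∑ j, t' j ^ 2 < ∑ j, t j ^ 2 ∧ ∀ j, j ≠ i → j ≠ i + 1 → t' j = t j := by
  have : Fact (1 < n) := ⟨hn⟩
  have hne : i ≠ i + 1 := by simp
  have hgap : t i ≠ t (i + 1) + 1 := by
    intro h
    refine hne (ht.1 ?_)
    change i + (t i : ZMod n) = i + 1 + (t (i + 1) : ZMod n)
    rw [h]
    push_cast
    ring
  set t' : ZMod n → ℕ :=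
    fun j => if j = i then t (i + 1) + 1 else if j = i + 1 then t i - 1 else t j with ht'
  have h1 : t' i = t (i + 1) + 1 := by simp [ht']
  have h2 : t' (i + 1) = t i - 1 := by simp [ht']
  have h3 : ∀ j, j ≠ i → j ≠ i + 1 → t' j = t j := fun j a b => by simp [ht', a, b]
  have hsum : ∀ g : ZMod n → ℕ,
      ∑ j, g j = g i + g (i + 1) + ∑ j ∈ Finset.univ \ {i, i + 1}, g j := by
    intro g
    rw [← Finset.sum_pair hne, add_comm, Finset.sum_sdiff (Finset.subset_univ _)]
  have hrest : ∀ g : ℕ → ℕ, ∑ j ∈ Finset.univ \ {i, i + 1}, g (t' j) =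
      ∑ j ∈ Finset.univ \ {i, i + 1}, g (t j) := by
    intro g
    refine Finset.sum_congr rfl fun j hj => ?_
    simp only [Finset.mem_sdiff, Finset.mem_univ, Finset.mem_insert, Finset.mem_singleton,
      true_and, not_or] at hj
    rw [h3 j hj.1 hj.2]
  refine ⟨t', ?_, ?_, ?_, h3⟩
  · have h : (fun j : ZMod n => j + (t' j : ZMod n)) =
        (fun j : ZMod n => j + (t j : ZMod n)) ∘ Equiv.swap i (i + 1) := by
      funext j
      simp only [Function.comp_apply]
      rcases eq_or_ne j i with rfl | hji
      · rw [h1, Equiv.swap_apply_left]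
        push_cast
        ring
      rcases eq_or_ne j (i + 1) with rfl | hji'
      · rw [h2, Equiv.swap_apply_right, Nat.cast_sub (by omega)]
        push_cast
        ring
      rw [h3 j hji hji', Equiv.swap_apply_of_ne_of_ne hji hji']
    unfold IsJugglingFun
    rw [h]
    exact Function.Bijective.comp ht (Equiv.bijective _)
  · have := hrest id
    simp only [id] at this
    rw [hsum t', hsum t, h1, h2, this]
    omega
  · rw [hsum (fun j => t' j ^ 2), hsum (fun j => t j ^ 2), hrest (· ^ 2), h1, h2]
    obtain ⟨c, hc⟩ : ∃ c, t i = t (i + 1) + 2 + c := ⟨t i - t (i + 1) - 2, by omega⟩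
    have : t i - 1 = t (i + 1) + 1 + c := by omega
    rw [this, hc]
    nlinarith

end IsJugglingFun

lemma eq_const_of_le_add_one {n : ℕ} [NeZero n] {t : ZMod n → ℕ}
    (h : ∀ i, t i ≤ t (i + 1)) (i : ZMod n) : t i = t 0 := by
  have hsum : ∑ i, t i = ∑ i, t (i + 1) :=
    (Equiv.sum_comp (Equiv.addRight (1 : ZMod n)) t).symm
  have heq := (Finset.sum_eq_sum_iff_of_le fun i _ => h i).1 hsum
  have hnat : ∀ k : ℕ, t (k : ZMod n) = t 0 := by
    intro k
    induction k with
    | zero => simp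
    | succ k ih => rw [Nat.cast_succ, ← heq _ (Finset.mem_univ _), ih]
  simpa using hnat i.val

/-- Juggling functions of period `n` with at most `b` balls. -/
def jugglingFuns (n b : ℕ) [NeZero n] : Set (ZMod n → ℕ) :=
  {t | IsJugglingFun t ∧ ∑ i, t i ≤ b * n}

section Connected

variable {n b : ℕ} [NeZero n]

instance finite_jugglingFuns : Finite (jugglingFuns n b) := by
  refine Set.Finite.subset (Set.finite_Iic fun _ : ZMod n => b * n) ?_
  rintro t ⟨-, ht⟩ i
  exact (Finset.single_le_sum (fun _ _ => Nat.zero_le _) (Finset.mem_univ i)).trans ht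

/-- Rotation of a juggling function. -/
def jugglingRotate (r : ZMod n) : Equiv.Perm (jugglingFuns n b) where
  toFun t := ⟨fun i => t.1 (i - r), t.2.1.rotate r, by
    exact (Equiv.sum_comp (Equiv.subRight r) t.1).trans_le t.2.2⟩
  invFun t := ⟨fun i => t.1 (i - (-r)), t.2.1.rotate (-r), by
    exact (Equiv.sum_comp (Equiv.subRight (-r)) t.1).trans_le t.2.2⟩
  left_inv t := by ext i; simp
  right_inv t := by ext i; simp

variable {s : ℕ} {O : Set (jugglingFuns n b)}

lemma mem_iff_rotate_mul_mem (hrot : ∀ t, t ∈ O ↔ jugglingRotate (s : ZMod n) t ∈ O) (m : ℕ) :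
    ∀ t, t ∈ O ↔ jugglingRotate ((m * s : ℕ) : ZMod n) t ∈ O := by
  induction m with
  | zero =>
    intro t
    have : jugglingRotate ((0 * s : ℕ) : ZMod n) t = t := by
      ext i
      simp [jugglingRotate]
    rw [this]
  | succ m ih =>
    intro t
    have : jugglingRotate (((m + 1) * s : ℕ) : ZMod n) t =
        jugglingRotate (s : ZMod n) (jugglingRotate ((m * s : ℕ) : ZMod n) t) := by
      ext i
      simp only [jugglingRotate, Equiv.coe_fn_mk]
      push_cast
      ring_nf
    rw [this, ← hrot, ← ih]

/-- Two juggling functions that differ at most at two adjacent positions are connected. -/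
lemma mem_iff_mem_of_eq_off_pair (hs : s < n) (hgcd : n.gcd s < n - s)
    (hrot : ∀ t, t ∈ O ↔ jugglingRotate (s : ZMod n) t ∈ O)
    (hsuf : ∀ t u : jugglingFuns n b,
      (∀ j < s, t.1 ((j : ZMod n) - s) = u.1 ((j : ZMod n) - s)) → t ∈ O → u ∈ O)
    (t u : jugglingFuns n b) (i : ZMod n)
    (htu : ∀ j, j ≠ i → j ≠ i + 1 → t.1 j = u.1 j) : t ∈ O ↔ u ∈ O := by
  set d := n.gcd s with hd
  have hdpos : 0 < d := Nat.gcd_pos_of_pos_left _ (NeZero.pos n)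
  obtain ⟨m, hm⟩ : ∃ m : ℕ, ((m * s : ℕ) : ZMod n) = -((i.val / d * d : ℕ) : ZMod n) := by
    obtain ⟨y, hy⟩ : ∃ y : ZMod n, (d : ZMod n) = s * y := by
      refine ⟨(Nat.gcdB n s : ℤ), ?_⟩
      have := congrArg (Int.cast : ℤ → ZMod n) (Nat.gcd_eq_gcd_ab n s)
      push_cast at this
      simpa using this
    refine ⟨(-y * (i.val / d : ℕ)).val, ?_⟩
    push_cast
    rw [ZMod.natCast_zmod_val, hy]
    ring
  have hi : i = ((i.val / d * d + i.val % d : ℕ) : ZMod n) := by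
    rw [Nat.div_add_mod']
    simp
  have hlt : i.val % d < d := Nat.mod_lt _ hdpos
  have hagree : ∀ j < s, (jugglingRotate ((m * s : ℕ) : ZMod n) t).1 ((j : ZMod n) - s) =
      (jugglingRotate ((m * s : ℕ) : ZMod n) u).1 ((j : ZMod n) - s) := by
    intro j hj
    have hcast : (j : ZMod n) - s = ((n - s + j : ℕ) : ZMod n) := by
      push_cast [Nat.cast_sub hs.le]
      simp
      ring
    have hne : ∀ e < n - s, (j : ZMod n) - s ≠ (e : ℕ) := by
      intro e he h
      rw [hcast] at h
      have := congrArg ZMod.val h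
      rw [ZMod.val_natCast_of_lt (by omega), ZMod.val_natCast_of_lt (by omega)] at this
      omega
    refine htu _ (fun h => hne (i.val % d) (by omega) ?_) fun h =>
      hne (i.val % d + 1) (by omega) ?_
    · rw [hm] at h
      have h' := sub_eq_iff_eq_add.1 h
      rw [h']
      nth_rw 1 [hi]
      push_cast
      ring
    · rw [hm] at h
      have h' := sub_eq_iff_eq_add.1 h
      rw [h']
      nth_rw 1 [hi]
      push_cast
      ring
  rw [mem_iff_rotate_mul_mem hrot m t, mem_iff_rotate_mul_mem hrot m u]
  exact ⟨hsuf _ _ hagree, hsuf _ _ fun j hj => (hagree j hj).symm⟩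

/-- Every juggling function is connected to the constant function with the same sum. -/
lemma mem_iff_const_mem (hn : 1 < n)
    (hpair : ∀ (t u : jugglingFuns n b) (i : ZMod n),
      (∀ j, j ≠ i → j ≠ i + 1 → t.1 j = u.1 j) → (t ∈ O ↔ u ∈ O))
    (k : ℕ) (hk : (fun _ => k) ∈ jugglingFuns n b) (t : jugglingFuns n b)
    (ht : ∑ i, t.1 i = k * n) : t ∈ O ↔ ⟨fun _ => k, hk⟩ ∈ O := by
  induction hN : ∑ i, t.1 i ^ 2 using Nat.strong_induction_on generalizing t with
  | _ N ih =>
    by_cases hasc : ∀ i, t.1 i ≤ t.1 (i + 1)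
    · have hconst := eq_const_of_le_add_one hasc
      have h0 : t.1 0 = k := by
        rw [Finset.sum_congr rfl fun i _ => hconst i] at ht
        simp only [Finset.sum_const, Finset.card_univ, ZMod.card, smul_eq_mul] at ht
        rw [mul_comm] at ht
        exact Nat.eq_of_mul_eq_mul_right (NeZero.pos n) ht
      have : t = ⟨fun _ => k, hk⟩ := by
        ext i
        rw [hconst i, h0]
      rw [this]
    · push Not at hasc
      obtain ⟨i, hi⟩ := hasc
      obtain ⟨t', hjug, hsum, hsq, hoff⟩ := t.2.1.exists_flatter hn hi
      have ht' : t' ∈ jugglingFuns n b := ⟨hjug, hsum.trans_le t.2.2⟩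
      rw [hpair t ⟨t', ht'⟩ i fun j h1 h2 => (hoff j h1 h2).symm]
      exact ih _ (hN ▸ hsq) ⟨t', ht'⟩ (hsum.trans ht) rfl

lemma zero_mem_jugglingFuns : (fun _ => 0) ∈ jugglingFuns n b := by
  refine ⟨?_, by simp⟩
  simp [IsJugglingFun]

/-- The overlap digraph of juggling functions is connected. -/
lemma jugglingFuns_connected (hs : s < n) (hn : 1 < n) (hgcd : n.gcd s < n - s)
    (hne : O.Nonempty)
    (hrot : ∀ t, t ∈ O ↔ jugglingRotate (s : ZMod n) t ∈ O)
    (hsuf : ∀ t u : jugglingFuns n b,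
      (∀ j < s, t.1 ((j : ZMod n) - s) = u.1 ((j : ZMod n) - s)) → t ∈ O → u ∈ O) :
    O = Set.univ := by
  have hpair := mem_iff_mem_of_eq_off_pair hs hgcd hrot hsuf
  have hzero : ∀ t : jugglingFuns n b, t ∈ O ↔ ⟨fun _ => 0, zero_mem_jugglingFuns⟩ ∈ O := by
    intro t
    obtain ⟨k, hk⟩ := t.2.1.dvd_sum
    rw [mul_comm] at hk
    have hkb : k * n ≤ b * n := hk ▸ t.2.2
    have hc : (fun _ => k) ∈ jugglingFuns n b := by
      refine ⟨(Equiv.addRight (k : ZMod n)).bijective, ?_⟩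
      simpa [mul_comm] using hkb
    have hpk : (fun i => if i = 0 then k * n else 0) ∈ jugglingFuns n b := by
      refine ⟨?_, by simpa using hkb⟩
      have : (fun i : ZMod n => i + (((if i = 0 then k * n else 0 : ℕ)) : ZMod n)) = id := by
        funext i
        split_ifs <;> simp
      unfold IsJugglingFun
      rw [this]
      exact Function.bijective_id
    rw [mem_iff_const_mem hn hpair k hc t hk,
      ← mem_iff_const_mem hn hpair k hc ⟨_, hpk⟩ (by simp)]
    exact hpair _ _ 0 fun j h _ => by simp [h]
  obtain ⟨t, ht⟩ := hne
  exact Set.eq_univ_of_forall fun u => (hzero u).2 ((hzero t).1 ht)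

end Connected

/-! ### From functions to lists -/

section Lists

variable {n : ℕ}

/-- The list of values `t 0, …, t (n - 1)`. -/
def jugglingList (t : ZMod n → ℕ) : List ℕ := List.ofFn fun i : Fin n => t ((i : ℕ) : ZMod n)

lemma natCast_fin_bijective [NeZero n] : Function.Bijective fun i : Fin n => ((i : ℕ) : ZMod n) := by
  refine Function.bijective_iff_has_inverse.2 ⟨fun x => ⟨x.val, x.val_lt⟩, fun i => ?_, fun x => ?_⟩
  · ext
    simp [ZMod.val_natCast_of_lt i.2]
  · simp

lemma jugglingList_injective [NeZero n] : Function.Injective (jugglingList (n := n)) := by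
  intro t u h
  have h' := List.ofFn_injective h
  funext x
  obtain ⟨i, rfl⟩ := natCast_fin_bijective.2 x
  exact congrFun h' i

lemma isJugglingList_jugglingList_iff [NeZero n] (t : ZMod n → ℕ) :
    IsJugglingList n (jugglingList t) ↔ IsJugglingFun t := by
  have hlen : (jugglingList t).length = n := by simp [jugglingList]
  rw [IsJugglingList, and_iff_right hlen, IsJugglingFun,
    ← natCast_fin_bijective.of_comp_iff (fun i : ZMod n => i + (t i : ZMod n)),
    ← natCast_fin_bijective.of_comp_iff']
  refine iff_of_eq (congrArg _ ?_)
  funext i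
  simp [jugglingList]

lemma sum_jugglingList [NeZero n] (t : ZMod n → ℕ) : (jugglingList t).sum = ∑ i, t i := by
  rw [jugglingList, List.sum_ofFn]
  exact natCast_fin_bijective.sum_comp t

lemma jugglingList_getD {T : List ℕ} (hT : T.length = n) :
    jugglingList (fun x : ZMod n => T.getD x.val 0) = T := by
  refine List.ext_getElem (by simp [jugglingList, hT]) fun i h1 h2 => ?_
  simp [jugglingList, ZMod.val_natCast, Nat.mod_eq_of_lt (hT ▸ h2 : i < n), h2]

lemma drop_jugglingList_eq_take {s : ℕ} (hs : s ≤ n) {t u : ZMod n → ℕ}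
    (h : ∀ j < s, u (j : ZMod n) = t ((j : ZMod n) - s)) :
    (jugglingList t).drop (n - s) = (jugglingList u).take s := by
  refine List.ext_getElem (by simp [jugglingList]; omega) fun i h1 h2 => ?_
  have hi : i < s := by
    simp only [List.length_take] at h2
    omega
  simp only [jugglingList, List.getElem_drop, List.getElem_take, List.getElem_ofFn]
  rw [h i hi]
  congr 1
  push_cast [Nat.cast_sub hs]
  simp
  ring

end Lists

lemma exists_isOvCycle_of_gcd_lt {n s : ℕ} (b : ℕ) (hs : 1 ≤ s) (hsn : s < n)
    (hgcd : n.gcd s < n - s) :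
    ∃ L, IsOvCycle n s {T : List ℕ | IsJugglingList n T ∧ T.sum ≤ b * n} L := by
  have : NeZero n := ⟨by omega⟩
  obtain ⟨σ, hσ, htrans⟩ := exists_perm_sameCycle_of_connected
    (fun (t : jugglingFuns n b) (j : Fin s) => t.1 ((j : ℕ) : ZMod n))
    (fun (t : jugglingFuns n b) (j : Fin s) => t.1 (((j : ℕ) : ZMod n) - s))
    (jugglingRotate (s : ZMod n)) (fun _ => rfl) ⟨_, zero_mem_jugglingFuns⟩
    (fun O hne hrot hsuf => jugglingFuns_connected hsn (by omega) hgcd hne hrot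
      fun t u h => hsuf t u (funext fun j => h j j.2))
  obtain ⟨L, hnd, hmem, hnext⟩ := exists_list_of_sameCycle σ _ htrans
  refine ⟨L.map fun t => jugglingList t.1,
    hnd.map fun t u h => Subtype.ext (jugglingList_injective h), fun T => ?_, fun i => ?_⟩
  · constructor
    · intro hT
      obtain ⟨t, -, rfl⟩ := List.mem_map.1 hT
      refine ⟨(isJugglingList_jugglingList_iff _).2 t.2.1, ?_⟩
      rw [sum_jugglingList]
      exact t.2.2
    · rintro ⟨hT, hsum⟩
      have hT' := jugglingList_getD hT.1
      refine List.mem_map.2 ⟨⟨fun x : ZMod n => T.getD x.val 0, ?_, ?_⟩, hmem _, hT'⟩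
      · rwa [← isJugglingList_jugglingList_iff, hT']
      · rwa [← sum_jugglingList, hT']
  · have hi : (i : ℕ) < L.length := by simpa using i.2
    have h := hnext ⟨i, hi⟩
    simp only [List.get_eq_getElem, List.getElem_map, List.length_map] at h ⊢
    refine drop_jugglingList_eq_take hsn.le fun j hj => ?_
    rw [h]
    exact congrFun (hσ _) ⟨j, hj⟩

/-! ### Necessity -/

/-- Every throw of `T` lands in its own block of length `d`. -/
def LandsInOwnBlock (n d : ℕ) (T : List ℕ) : Prop :=
  ∀ i < n, (i + T.getD i 0) % n / d = i / d

lemma LandsInOwnBlock.of_drop_eq_take {n d : ℕ} (hd : 0 < d) (hdn : d ∣ n)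
    {T U : List ℕ} (hT : IsJugglingList n T) (hU : IsJugglingList n U)
    (hTU : T.drop d = U.take (n - d)) (h : LandsInOwnBlock n d T) : LandsInOwnBlock n d U := by
  obtain ⟨m, rfl⟩ := hdn
  have hfirst : ∀ i < d * m - d, (i + U.getD i 0) % (d * m) / d = i / d := by
    intro i hi
    have hval : U.getD i 0 = T.getD (i + d) 0 := by
      have h1 : (U.take (d * m - d)).getD i 0 = U.getD i 0 := by
        simp [List.getD_eq_getElem?_getD, hi]
      have h2 : (T.drop d).getD i 0 = T.getD (i + d) 0 := by
        simp [List.getD_eq_getElem?_getD, add_comm]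
      rw [← h1, ← hTU, h2]
    have h3 := h (i + d) (by omega)
    rw [hval]
    generalize T.getD (i + d) 0 = x at h3 ⊢
    rw [Nat.add_div_right _ hd] at h3
    have hy : d ≤ (i + d + x) % (d * m) := by
      by_contra hlt
      rw [Nat.div_eq_of_lt (not_le.1 hlt)] at h3
      exact absurd h3.symm (Nat.succ_ne_zero _)
    obtain ⟨z, hz⟩ := Nat.exists_eq_add_of_le' hy
    have hzlt : z < d * m := by
      have := Nat.mod_lt (i + d + x) (show 0 < d * m by omega)
      omega
    have hmod : (i + x) % (d * m) = z := by
      have h4 : z + d ≡ i + x + d [MOD d * m] := by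
        rw [← hz, show i + x + d = i + d + x by ring]
        exact Nat.mod_modEq _ _
      rw [← Nat.ModEq.add_right_cancel' d h4, Nat.mod_eq_of_lt hzlt]
    rw [hz, Nat.add_div_right _ hd] at h3
    rw [hmod]
    omega
  intro i hi
  by_cases hid : i < d * m - d
  · exact hfirst i hid
  have hpos : 0 < d * m := by omega
  have hsub : d * m - d = d * (m - 1) := by rw [Nat.mul_sub, mul_one]
  have hmpos : 0 < m := Nat.pos_of_mul_pos_left hpos
  have hdivlast : ∀ v, v < d * m → d * m - d ≤ v → v / d = m - 1 := by
    intro v h1 h2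
    refine Nat.div_eq_of_lt_le ?_ ?_
    · rw [mul_comm, ← hsub]
      exact h2
    · rw [Nat.sub_add_cancel hmpos, mul_comm]
      exact h1
  have hinj : ∀ x < d * m, ∀ y < d * m,
      (x + U.getD x 0) % (d * m) = (y + U.getD y 0) % (d * m) → x = y := by
    intro x hx y hy hxy
    have := @hU.2.1 ⟨x, hx⟩ ⟨y, hy⟩ (Fin.ext hxy)
    simpa using this
  have hlast : d * m - d ≤ (i + U.getD i 0) % (d * m) := by
    by_contra hlt
    have hsurj : Set.SurjOn (fun x => (x + U.getD x 0) % (d * m))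
        (Finset.range (d * m - d)) (Finset.range (d * m - d)) := by
      refine Finset.surjOn_of_injOn_of_card_le _ (fun x hx => ?_) (fun x hx y hy hxy => ?_) le_rfl
      · have hx' : x < d * m - d := by simpa using hx
        have h5 := hfirst x hx'
        have h6 : x / d < m - 1 := Nat.div_lt_of_lt_mul (hsub ▸ hx')
        rw [← h5, Nat.div_lt_iff_lt_mul hd, mul_comm (m - 1), ← hsub] at h6
        exact Finset.mem_coe.2 (Finset.mem_range.2 h6)
      · have hx' : x < d * m - d := by simpa using hx
        have hy' : y < d * m - d := by simpa using hy
        exact hinj x (by omega) y (by omega) hxy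
    obtain ⟨x, hx, hxi⟩ := hsurj (show (i + U.getD i 0) % (d * m) ∈ _ by exact Finset.mem_coe.2 (Finset.mem_range.2 (not_le.1 hlt)))
    have hx' : x < d * m - d := by simpa using hx
    have := hinj x (by omega) i hi hxi
    omega
  rw [hdivlast _ (Nat.mod_lt _ hpos) hlast, hdivlast i hi (by omega)]

/-- A property that passes from each entry of a list to the cyclically next one holds for all
entries as soon as it holds for one. -/
lemma forall_mem_of_cyclic_step {α : Type*} {L : List α} {P : α → Prop}
    (hstep : ∀ i : Fin L.length, P (L.get i) →
      P (L.get ⟨((i : ℕ) + 1) % L.length, Nat.mod_lt _ i.pos⟩))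
    {x y : α} (hx : x ∈ L) (hPx : P x) (hy : y ∈ L) : P y := by
  obtain ⟨i, rfl⟩ := List.get_of_mem hx
  obtain ⟨j, rfl⟩ := List.get_of_mem hy
  have hiter : ∀ k : ℕ, P (L.get ⟨((i : ℕ) + k) % L.length, Nat.mod_lt _ i.pos⟩) := by
    intro k
    induction k with
    | zero => simpa [Nat.mod_eq_of_lt i.2] using hPx
    | succ k ih =>
      have := hstep _ ih
      simpa [Nat.add_assoc] using this
  have h := hiter (L.length - i + j)
  have hidx : ((i : ℕ) + (L.length - i + j)) % L.length = j := by
    rw [show (i : ℕ) + (L.length - i + j) = j + L.length by omega, Nat.add_mod_right,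
      Nat.mod_eq_of_lt j.2]
  simpa only [hidx] using h

lemma isJugglingList_replicate {n : ℕ} (hn : 0 < n) (c : ℕ) :
    IsJugglingList n (List.replicate n c) := by
  have : NeZero n := ⟨hn.ne'⟩
  have h : List.replicate n c = jugglingList fun _ : ZMod n => c := by
    simp [jugglingList]
  rw [h, isJugglingList_jugglingList_iff]
  exact (Equiv.addRight (c : ZMod n)).bijective

lemma gcd_lt_of_isOvCycle {n s b : ℕ} (hb : 0 < b) (hs : 1 ≤ s) (hsn : s < n)
    {L : List (List ℕ)}
    (hL : IsOvCycle n s {T : List ℕ | IsJugglingList n T ∧ T.sum ≤ b * n} L) :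
    n.gcd s < n - s := by
  by_contra hle
  obtain ⟨-, hmem, hov⟩ := hL
  set d := n - s with hd
  have hdpos : 0 < d := by omega
  have hdn : d ∣ n := by
    have h1 : n.gcd s ∣ d := Nat.dvd_sub (Nat.gcd_dvd_left _ _) (Nat.gcd_dvd_right _ _)
    have h2 : n.gcd s = d := le_antisymm (Nat.le_of_dvd hdpos h1) (not_lt.1 hle)
    exact h2 ▸ Nat.gcd_dvd_left _ _
  have hones : LandsInOwnBlock n d (List.replicate n 1) := by
    refine forall_mem_of_cyclic_step (L := L) (x := List.replicate n 0) (fun i hi => ?_)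
      ((hmem _).2 ⟨isJugglingList_replicate (by omega) 0, by simp⟩) (fun i hi => ?_)
      ((hmem _).2 ⟨isJugglingList_replicate (by omega) 1, ?_⟩)
    · refine hi.of_drop_eq_take hdpos hdn ((hmem _).1 (List.get_mem _ _)).1
        ((hmem _).1 (List.get_mem _ _)).1 ?_
      rw [show n - d = s by omega]
      exact hov i
    · simp [List.getD_eq_getElem?_getD, hi, Nat.mod_eq_of_lt hi]
    · simpa using Nat.le_mul_of_pos_left n hb
  have h := hones (d - 1) (by omega)
  have hlt : d - 1 < n := by omega
  simp only [List.getD_eq_getElem?_getD, List.getElem?_replicate, hlt, if_true,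
    Option.getD_some] at h
  rw [Nat.sub_add_cancel hdpos, Nat.mod_eq_of_lt (by omega), Nat.div_self hdpos,
    Nat.div_eq_of_lt (by omega)] at h
  exact one_ne_zero h

/-- for positive `n, s, b` with `1 ≤ s ≤ n-1`, an `s`-overlap cycle on
the set of juggling sequences of period `n` using at most `b` balls (entries summing
to at most `b·n`) exists iff `n - s > gcd(n,s)`. -/
theorem stmt_10 (n s b : ℕ) (hn : 0 < n) (hb : 0 < b) (hs1 : 1 ≤ s) (hsn : s ≤ n - 1) :
    (∃ L, IsOvCycle n s
        {T : List ℕ | IsJugglingList n T ∧ T.sum ≤ b * n} L) ↔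
      n - s > Nat.gcd n s := by
  constructor
  · rintro ⟨L, hL⟩
    exact gcd_lt_of_isOvCycle hb hs1 (by omega) hL
  · exact exists_isOvCycle_of_gcd_lt b hs1 (by omega)
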